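/- Let d = 2m + 1 ≥ 5 be odd and let g ∈ ℝ[x,y]_d be nonzero with complex rank Csr(g) = m + 1. Suppose that in a decomposition g = Σ_{i=1}^{m+1} a_i M_i^d with nonzero a_i ∈ ℂ and pairwise non-proportional M_i ∈ ℂ[x,y]_1, at least one M_i is not proportional to any real linear form. Then Rsr(g) ≥ m + 2. -/

import Mathlib

/-!
We model the space `K[x,y]_d` of degree-`d` homogeneous bivariate forms over `K`
by its coefficient vectors `Fin (d+1) → K`, where `f i` is the coefficient of
`x^i * y^(d-i)`.  A linear form `p*x + q*y ∈ K[x,y]_1` is modeled by the pair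
`(p, q) : K × K`; `powVec d (p,q)` is the coefficient vector of `(p*x + q*y)^d`.
-/

/-- Coefficient vector of `(p*x + q*y)^d` in the basis `x^i y^(d-i)`. -/
noncomputable def powVec {K : Type*} [CommRing K] (d : ℕ) (L : K × K) :
    Fin (d + 1) → K :=
  fun i => (d.choose (i : ℕ) : K) * L.1 ^ (i : ℕ) * L.2 ^ (d - (i : ℕ))

/-- The rank over `K` of a degree-`d` form: the minimal `r` such that
`f = ∑_{i=1}^r c_i L_i^d` with `c_i ∈ K` and linear forms `L_i ∈ K[x,y]_1`. -/
noncomputable def rankK (K : Type*) [CommRing K] (d : ℕ) (f : Fin (d + 1) → K) : ℕ :=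
  sInf {r : ℕ | ∃ (c : Fin r → K) (L : Fin r → K × K), f = ∑ i, c i • powVec d (L i)}

/-- The real rank `Rsr` of a real binary form of degree `d`. -/
noncomputable def Rsr (d : ℕ) (f : Fin (d + 1) → ℝ) : ℕ := rankK ℝ d f

/-- The complex rank `Csr` of a complex binary form of degree `d`. -/
noncomputable def Csr (d : ℕ) (f : Fin (d + 1) → ℂ) : ℕ := rankK ℂ d f

/-- A real form regarded as a complex form (coefficientwise inclusion `ℝ ↪ ℂ`). -/
noncomputable def complexify {d : ℕ} (f : Fin (d + 1) → ℝ) : Fin (d + 1) → ℂ :=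
  fun i => (f i : ℂ)

/-- `t` is a typical rank in degree `d`: there is a nonempty euclidean-open set of
real degree-`d` forms on which the real rank is constantly `t`. -/
def IsTypicalRank (d t : ℕ) : Prop :=
  ∃ V : Set (Fin (d + 1) → ℝ), IsOpen V ∧ V.Nonempty ∧ ∀ f ∈ V, Rsr d f = t

/-- Two linear forms (modeled as coefficient pairs) are proportional if one is a
scalar multiple of the other. -/
def AreProportional {K : Type*} [CommRing K] (u v : K × K) : Prop :=
  ∃ t : K, v = t • u ∨ u = t • v

/-- A complex linear form (as a coefficient pair) is real, i.e. proportional to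
a linear form with real coefficients. -/
def IsRealForm (v : ℂ × ℂ) : Prop :=
  ∃ (N : ℝ × ℝ) (t : ℂ), N ≠ 0 ∧ v = t • ((N.1 : ℂ), (N.2 : ℂ))

/-- Product of `d` linear forms, evaluated at `L`, is a linear functional of the `d`-th power
of the form `L` (apolarity). -/
theorem exists_linearMap_powVec_eq_prod {K ι : Type*} [Field K] [CharZero K] [Fintype ι]
    {d : ℕ} (hd : Fintype.card ι = d) (u : ι → K × K) :
    ∃ φ : (Fin (d + 1) → K) →ₗ[K] K,
      ∀ L, φ (powVec d L) = ∏ k, ((u k).1 * L.1 + (u k).2 * L.2) := by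
  classical
  have hcard (t : Finset ι) : t.card ≤ d := hd ▸ t.card_le_univ
  refine ⟨∑ t : Finset ι, ((∏ k ∈ t, (u k).1) * (∏ k ∈ Finset.univ \ t, (u k).2) *
    (d.choose t.card : K)⁻¹) • LinearMap.proj ⟨t.card, Nat.lt_succ_of_le (hcard t)⟩, fun L => ?_⟩
  rw [Finset.prod_add, Finset.powerset_univ, LinearMap.sum_apply]
  refine Finset.sum_congr rfl fun t _ => ?_
  have hc : (d.choose t.card : K) ≠ 0 := by
    exact_mod_cast (Nat.choose_pos (hcard t)).ne'
  have h : (Finset.univ \ t).card = d - t.card := by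
    rw [Finset.card_sdiff_of_subset t.subset_univ, Finset.card_univ, hd]
  simp only [LinearMap.smul_apply, LinearMap.proj_apply, powVec, smul_eq_mul,
    Finset.prod_mul_distrib, Finset.prod_const, h]
  field_simp

/-- A vector of the plane off the line spanned by `w` is separated from `w` by a linear form. -/
theorem exists_linear_form_separating {K : Type*} [Field K] {v w : K × K}
    (h : ∀ t : K, v ≠ t • w) :
    ∃ u : K × K, u.1 * v.1 + u.2 * v.2 ≠ 0 ∧ u.1 * w.1 + u.2 * w.2 = 0 := by
  obtain ⟨v₁, v₂⟩ := v
  obtain ⟨w₁, w₂⟩ := w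
  simp only [ne_eq, Prod.smul_mk, smul_eq_mul, Prod.mk.injEq, not_and] at h
  by_cases hw₁ : w₁ = 0
  · subst hw₁
    by_cases hv₁ : v₁ = 0
    · subst hv₁
      by_cases hw₂ : w₂ = 0
      · exact ⟨(0, 1), by simpa using fun hv => h 0 (by simp) (by simp [hv]), by simp [hw₂]⟩
      · exact absurd (by field_simp) (h (v₂ / w₂) (by simp))
    · exact ⟨(1, 0), by simpa using hv₁, by simp⟩
  · refine ⟨(w₂, -w₁), fun hz => h (v₁ / w₁) (by field_simp) ?_, by simp; ring⟩
    field_simp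
    linear_combination -hz

/-- A form not proportional to any of at most `d` given forms has its `d`-th power separated
from theirs by a linear functional. -/
theorem exists_linearMap_powVec_separating {K ι : Type*} [Field K] [CharZero K] [Fintype ι]
    {d : ℕ} (hd : Fintype.card ι ≤ d) {v : K × K} (hv : v ≠ 0) {w : ι → K × K}
    (h : ∀ k, ∀ t : K, v ≠ t • w k) :
    ∃ φ : (Fin (d + 1) → K) →ₗ[K] K,
      φ (powVec d v) ≠ 0 ∧ ∀ k, φ (powVec d (w k)) = 0 := by
  choose u hu hu' using fun k => exists_linear_form_separating (h k)
  obtain ⟨u₀, hu₀, -⟩ := exists_linear_form_separating (v := v) (w := 0) (by simpa using hv)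
  obtain ⟨φ, hφ⟩ := exists_linearMap_powVec_eq_prod (ι := ι ⊕ Fin (d - Fintype.card ι)) (d := d)
    (by simp; omega) (Sum.elim u fun _ => u₀)
  refine ⟨φ, ?_, fun k => ?_⟩
  · rw [hφ, Finset.prod_ne_zero_iff]
    rintro (k | k) -
    exacts [hu k, hu₀]
  · rw [hφ]
    exact Finset.prod_eq_zero (Finset.mem_univ (Sum.inl k)) (hu' k)

/-- Every form of degree `d` is a linear combination of `d + 1` powers of linear forms. -/
theorem exists_eq_sum_powVec {K : Type*} [Field K] [CharZero K] (d : ℕ) (f : Fin (d + 1) → K) :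
    ∃ (c : Fin (d + 1) → K) (L : Fin (d + 1) → K × K), f = ∑ i, c i • powVec d (L i) := by
  let p : Fin (d + 1) → K × K := fun k => (1, (k : ℕ))
  have hli : LinearIndependent K fun k => powVec d (p k) := by
    rw [Fintype.linearIndependent_iff]
    intro c hc k
    obtain ⟨φ, hφ, hφ'⟩ := exists_linearMap_powVec_separating
      (ι := {j // j ≠ k}) (d := d) (v := p k) (w := fun j => p j)
      (by simp) (by simp [p]) (by
        rintro ⟨j, hj⟩ t ht
        simp only [p, Prod.smul_mk, smul_eq_mul, mul_one, Prod.mk.injEq] at ht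
        rw [← ht.1, one_mul, Nat.cast_inj] at ht
        exact hj (Fin.ext ht.2.symm))
    have h := congrArg φ hc
    rw [map_sum, map_zero, Finset.sum_eq_single k (fun j _ hj => by
      rw [map_smul, hφ' ⟨j, hj⟩, smul_zero]) (by simp), map_smul, smul_eq_mul] at h
    exact (mul_eq_zero.mp h).resolve_right hφ
  let b := basisOfLinearIndependentOfCardEqFinrank hli (by simp)
  refine ⟨b.repr f, p, ?_⟩
  simpa [b] using (b.sum_repr f).symm

theorem complexify_sum_powVec {d r : ℕ} (c : Fin r → ℝ) (L : Fin r → ℝ × ℝ) :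
    complexify (∑ i, c i • powVec d (L i)) =
      ∑ i, (c i : ℂ) • powVec d (((L i).1 : ℂ), ((L i).2 : ℂ)) := by
  ext k
  simp [complexify, powVec, Finset.sum_apply]

/-- Let `d = 2m+1 ≥ 5` and let `g` be a nonzero real binary form of degree `d`
with complex rank `m + 1`.  If in a decomposition
`g = ∑_{i=1}^{m+1} a_i M_i^d` (nonzero `a_i ∈ ℂ`, pairwise non-proportional
`M_i ∈ ℂ[x,y]_1`) at least one `M_i` is not proportional to a real linear form,
then `Rsr g ≥ m + 2`. -/
theorem real_rank_ge_of_nonreal_point (m : ℕ) (hm : 5 ≤ 2 * m + 1)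
    (g : Fin (2 * m + 1 + 1) → ℝ) (hg : g ≠ 0)
    (hrank : Csr (2 * m + 1) (complexify g) = m + 1)
    (a : Fin (m + 1) → ℂ) (ha : ∀ i, a i ≠ 0)
    (M : Fin (m + 1) → ℂ × ℂ) (hM0 : ∀ i, M i ≠ 0)
    (hMp : ∀ i j, i ≠ j → ¬ AreProportional (M i) (M j))
    (hdec : complexify g = ∑ i, a i • powVec (2 * m + 1) (M i))
    (hnr : ∃ i, ¬ IsRealForm (M i)) :
    m + 2 ≤ Rsr (2 * m + 1) g := by
  obtain ⟨i₀, hi₀⟩ := hnr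
  refine le_csInf ⟨_, exists_eq_sum_powVec _ g⟩ ?_
  rintro r ⟨c, L, hL⟩
  by_contra! hr
  obtain ⟨φ, hφ, hφ'⟩ := exists_linearMap_powVec_separating
    (ι := {i // i ≠ i₀} ⊕ Fin r) (d := 2 * m + 1) (v := M i₀)
    (w := Sum.elim (fun i => M i) fun j => (((L j).1 : ℂ), ((L j).2 : ℂ)))
    (by simp; omega) (hM0 i₀) (by
      rintro (⟨i, hi⟩ | j) t ht
      · exact hMp i i₀ hi ⟨t, Or.inl ht⟩
      · refine hi₀ ⟨L j, t, fun h => hM0 i₀ ?_, ht⟩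
        simp only [Sum.elim_inr, h] at ht
        simpa [Prod.ext_iff] using ht)
  have h := congrArg φ hdec
  rw [hL, complexify_sum_powVec, map_sum, map_sum,
    Finset.sum_eq_zero fun j _ => by rw [map_smul]; exact smul_eq_zero_of_right _ (hφ' (.inr j)),
    Finset.sum_eq_single i₀ (fun i _ hi => by
      rw [map_smul]; exact smul_eq_zero_of_right _ (hφ' (.inl ⟨i, hi⟩))) (by simp),
    map_smul, smul_eq_mul] at h
  exact mul_ne_zero (ha i₀) hφ h.symm
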